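/- Let ρ = |Φ⟩⟨Φ| be the density matrix of the Bell state Φ = (e₀ ⊗ e₀ + e₁ ⊗ e₁)/√2 in ℂ² ⊗ ℂ² (indexed by Fin 2 × Fin 2, with entries ρ((i,k),(j,l)) = Φ(i,k) · conj(Φ(j,l))). Then there do not exist q ∈ ℕ, positive reals σ₁,…,σ_q, an orthonormal family u₁,…,u_q in ℂ^(Fin 2 × Fin 2), and an orthonormal family w₁,…,w_q in ℂ^(Fin 2 × Fin 2) such that t(ρ) = ∑_{i=1}^q σᵢ |uᵢ⟩⟨wᵢ| and mat(uᵢ), mat(wᵢ) are positive semidefinite for all i. That is, the Bell state cannot satisfy the hypotheses of the singular-value-decomposition sufficient criterion for separability. -/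

import Mathlib

open Matrix
open scoped ComplexOrder

noncomputable section

/-- The `mat` operator, inverse of `vec`: `(matM u) r c = u (c, r)`. -/
def matM {n : ℕ} (u : Fin n × Fin n → ℂ) : Matrix (Fin n) (Fin n) ℂ :=
  Matrix.of fun r c => u (c, r)

/-- The tilde transform: `tildeT Q ((c,r), (i,j)) = Q ((i,r), (j,c))`. -/
def tildeT {m n : ℕ} (Q : Matrix (Fin m × Fin n) (Fin m × Fin n) ℂ) :
    Matrix (Fin n × Fin n) (Fin m × Fin m) ℂ :=
  Matrix.of fun p q => Q (q.1, p.2) (q.2, p.1)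

/-- The outer product `|u⟩⟨v|`, with entries `u a * conj (v b)`. -/
def outerP {α β : Type*} (u : α → ℂ) (v : β → ℂ) : Matrix α β ℂ :=
  Matrix.of fun a b => u a * star (v b)

/-- The standard basis vectors of `ℂ²`. -/
def e₀ : Fin 2 → ℂ := fun i => if i = 0 then 1 else 0
def e₁ : Fin 2 → ℂ := fun i => if i = 1 then 1 else 0

/-- The Bell state `Φ = (e₀ ⊗ e₀ + e₁ ⊗ e₁)/√2` in `ℂ² ⊗ ℂ²`. -/
def bellΦ : Fin 2 × Fin 2 → ℂ :=
  fun p => (e₀ p.1 * e₀ p.2 + e₁ p.1 * e₁ p.2) / ((Real.sqrt 2 : ℝ) : ℂ)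

/-- The density matrix of the Bell state, `ρ = |Φ⟩⟨Φ|`. -/
def bellρ : Matrix (Fin 2 × Fin 2) (Fin 2 × Fin 2) ℂ := outerP bellΦ bellΦ

/-- A positive semidefinite 2 × 2 matrix with a vanishing diagonal entry is diagonal. -/
theorem Matrix.PosSemidef.fin_two_offDiag_eq_zero {A : Matrix (Fin 2) (Fin 2) ℂ}
    (hA : A.PosSemidef) (h : A 0 0 * A 1 1 = 0) : A 0 1 = 0 ∧ A 1 0 = 0 := by
  have hdet := hA.det_nonneg
  have hsymm : star (A 0 1) = A 1 0 := hA.isHermitian.apply 1 0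
  have hnonneg : 0 ≤ A 0 1 * star (A 0 1) := mul_star_self_nonneg _
  rw [Matrix.det_fin_two, h, ← hsymm, zero_sub, neg_nonneg] at hdet
  have h01 : A 0 1 = 0 := by simpa using le_antisymm hdet hnonneg
  exact ⟨h01, by rw [← hsymm, h01, star_zero]⟩

/-- The Bell state cannot satisfy the hypotheses of the singular-value-
decomposition sufficient criterion for separability: there is no decomposition
`t(ρ) = ∑ σᵢ |uᵢ⟩⟨wᵢ|` with `σᵢ > 0`, orthonormal families `{uᵢ}`, `{wᵢ}`, and
all `mat uᵢ`, `mat wᵢ` positive semidefinite. -/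
theorem bell_state_fails_svd_criterion :
    ¬ ∃ (q : ℕ) (σ : Fin q → ℝ) (u w : Fin q → (Fin 2 × Fin 2 → ℂ)),
        (∀ i, 0 < σ i) ∧
        (∀ i j, ∑ k, star (u i k) * u j k = if i = j then (1 : ℂ) else 0) ∧
        (∀ i j, ∑ k, star (w i k) * w j k = if i = j then (1 : ℂ) else 0) ∧
        tildeT bellρ = ∑ i, (σ i : ℂ) • outerP (u i) (w i) ∧
        (∀ i, (matM (u i)).PosSemidef) ∧
        (∀ i, (matM (w i)).PosSemidef) := by
  rintro ⟨q, σ, u, w, hσ, -, -, hsum, hu, hw⟩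
  have hdiag := congrFun (congrFun hsum (1, 1)) (0, 0)
  have hoff := congrFun (congrFun hsum (1, 0)) (0, 1)
  simp only [tildeT, bellρ, outerP, bellΦ, e₀, e₁, Matrix.sum_apply, Matrix.smul_apply,
    Matrix.of_apply, smul_eq_mul] at hdiag hoff
  have hnonneg : ∀ k ∈ Finset.univ, 0 ≤ (σ k : ℂ) * (u k (1, 1) * star (w k (0, 0))) :=
    fun k _ => mul_nonneg (by exact_mod_cast (hσ k).le)
      (mul_nonneg ((hu k).diag_nonneg (i := 1)) (star_nonneg_iff.mpr ((hw k).diag_nonneg (i := 0))))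
  have hzero := (Finset.sum_eq_zero_iff_of_nonneg hnonneg).mp (hdiag.symm.trans (by simp))
  have hterm : ∀ k, u k (1, 0) * star (w k (0, 1)) = 0 := by
    intro k
    have hk := (mul_eq_zero.mp (hzero k (Finset.mem_univ k))).resolve_left
      (by exact_mod_cast (hσ k).ne')
    rcases mul_eq_zero.mp hk with h | h
    · have h' : u k (1, 0) = 0 :=
        ((hu k).fin_two_offDiag_eq_zero (mul_eq_zero_of_right _ h)).1
      rw [h', zero_mul]
    · have h' : w k (0, 1) = 0 :=
        ((hw k).fin_two_offDiag_eq_zero (mul_eq_zero_of_left (star_eq_zero.mp h) _)).2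
      rw [h', star_zero, mul_zero]
  simp only [hterm, mul_zero, Finset.sum_const_zero] at hoff
  simp at hoff
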